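/- Let s > 0 and let Σ be an n×n real symmetric positive definite matrix such that every diagonal entry of Σ⁻¹ is at most 1/s. Then Σ̃ = (1/n!)·Σ_{σ ∈ S_n} P_σ·Σ·P_σᵀ is symmetric positive definite and every diagonal entry of Σ̃⁻¹ is at most 1/s. -/

import Mathlib

open Matrix

/-- Variational lower bound for the diagonal entries of the inverse of a positive definite
matrix. -/
theorem Matrix.PosDef.two_mul_sub_le_inv_apply_self {m : Type*} [Fintype m] [DecidableEq m]
    {A : Matrix m m ℝ} (hA : A.PosDef) (i : m) (x : m → ℝ) :
    2 * x i - x ⬝ᵥ A *ᵥ x ≤ A⁻¹ i i := by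
  have hdet : IsUnit A.det := (isUnit_iff_isUnit_det A).1 hA.isUnit
  have hsymm : Aᵀ = A := by simpa [conjTranspose_eq_transpose_of_trivial] using hA.isHermitian.eq
  set y := A⁻¹ *ᵥ Pi.single i 1 with hy
  have hAy : A *ᵥ y = Pi.single i 1 := by
    rw [hy, mulVec_mulVec, mul_nonsing_inv A hdet, one_mulVec]
  have hyi : y i = A⁻¹ i i := by simp [hy]
  have hcross : y ⬝ᵥ A *ᵥ x = x i := by
    rw [dotProduct_mulVec, ← mulVec_transpose, hsymm, hAy, single_one_dotProduct]
  have hnonneg := hA.posSemidef.dotProduct_mulVec_nonneg (y - x)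
  simp only [star_trivial, mulVec_sub, sub_dotProduct, dotProduct_sub, hAy, hcross,
    dotProduct_single_one, Pi.sub_apply, hyi] at hnonneg
  linarith

/-- An upper bound on a diagonal entry of the inverse is preserved by averaging positive
definite matrices. -/
theorem Matrix.PosDef.inv_average_apply_self_le {ι m : Type*} [Fintype ι] [Nonempty ι]
    [Fintype m] [DecidableEq m] {A : ι → Matrix m m ℝ} {B : Matrix m m ℝ} (hB : B.PosDef)
    (hBA : B = (Fintype.card ι : ℝ)⁻¹ • ∑ k, A k) (hA : ∀ k, (A k).PosDef) {i : m} {c : ℝ}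
    (hc : ∀ k, (A k)⁻¹ i i ≤ c) : B⁻¹ i i ≤ c := by
  have hcard : (0 : ℝ) < Fintype.card ι := by exact_mod_cast Fintype.card_pos
  have hdet : IsUnit B.det := (isUnit_iff_isUnit_det B).1 hB.isUnit
  set v := B⁻¹ *ᵥ Pi.single i 1 with hv
  have hvi : v i = B⁻¹ i i := by simp [hv]
  have hBv : v ⬝ᵥ B *ᵥ v = v i := by
    conv_lhs => rw [hv, mulVec_mulVec, mul_nonsing_inv B hdet, one_mulVec, ← hv]
    exact dotProduct_single_one v i
  have hsum : ∑ k, v ⬝ᵥ A k *ᵥ v = Fintype.card ι * v i := by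
    rw [← hBv, hBA, smul_mulVec, dotProduct_smul, smul_eq_mul, mul_inv_cancel_left₀ hcard.ne',
      sum_mulVec, dotProduct_sum]
  have hle : ∑ k, (2 * v i - v ⬝ᵥ A k *ᵥ v) ≤ ∑ _k : ι, c :=
    Finset.sum_le_sum fun k _ => ((hA k).two_mul_sub_le_inv_apply_self i v).trans (hc k)
  rw [Finset.sum_sub_distrib, hsum] at hle
  simp only [Finset.sum_const, Finset.card_univ, nsmul_eq_mul] at hle
  rw [← hvi]
  refine le_of_mul_le_mul_left ?_ hcard
  linarith

/-- Conjugation by a permutation matrix reindexes rows and columns. -/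
theorem Matrix.permMatrix_mul_mul_transpose {m : Type*} [Fintype m] [DecidableEq m]
    (σ : Equiv.Perm m) (S : Matrix m m ℝ) :
    σ.permMatrix ℝ * S * (σ.permMatrix ℝ)ᵀ = S.submatrix σ σ := by
  rw [transpose_permMatrix]
  ext i j
  have hinv : (Equiv.symm σ⁻¹) j = σ j := rfl
  simp [Equiv.Perm.permMatrix, PEquiv.toMatrix_toPEquiv_mul, PEquiv.mul_toMatrix_toPEquiv, hinv]



/-- the permutation-symmetrization of a feasible covariance matrix
remains privacy-feasible: diagonal entries of the inverse stay at most `1/s`. -/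
theorem stmt_18 (n : ℕ) (s : ℝ) (hs : 0 < s)
    (S : Matrix (Fin n) (Fin n) ℝ) (hS : S.PosDef)
    (hdiag : ∀ i, S⁻¹ i i ≤ 1 / s)
    (St : Matrix (Fin n) (Fin n) ℝ)
    (hSt : St = ((Nat.factorial n : ℝ))⁻¹ •
      ∑ σ : Equiv.Perm (Fin n), σ.permMatrix ℝ * S * (σ.permMatrix ℝ)ᵀ) :
    St.PosDef ∧ ∀ i, St⁻¹ i i ≤ 1 / s := by
  simp only [permMatrix_mul_mul_transpose] at hSt
  have hA (σ : Equiv.Perm (Fin n)) : (S.submatrix σ σ).PosDef := hS.submatrix σ.injective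
  have hB : St.PosDef := by
    rw [hSt]
    exact (posDef_sum Finset.univ_nonempty fun σ _ => hA σ).smul (by positivity)
  refine ⟨hB, fun i => hB.inv_average_apply_self_le (A := fun σ : Equiv.Perm (Fin n) =>
    S.submatrix σ σ) ?_ hA fun σ => ?_⟩
  · rw [hSt, Fintype.card_perm, Fintype.card_fin]
  · rw [inv_submatrix_equiv]
    exact hdiag (σ i)
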